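/- For a group X the following are equivalent: (1) the superextension λ(X) has a zero, i.e. there exists a maximal linked system Z on X such that A∘Z = Z = Z∘A for every maximal linked system A on X; (2) X is finite and |X| ∈ {1, 3, 5} (equivalently, X is isomorphic to the cyclic group C₁, C₃ or C₅). -/

import Mathlib

open Pointwise

/-- A family `L` of subsets of `X` is *linked* if any two of its members intersect
(in particular every member is nonempty). -/
def Linked {X : Type*} (L : Set (Set X)) : Prop :=
  ∀ A ∈ L, ∀ B ∈ L, (A ∩ B).Nonempty

/-- A family `L` of subsets of a group `X` is *invariant* if `xA ∈ L` for all `A ∈ L`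
and all `x ∈ X`. -/
def Invariant {X : Type*} [Group X] (L : Set (Set X)) : Prop :=
  ∀ x : X, ∀ A ∈ L, x • A ∈ L

/-- A *maximal invariant linked system* on a group `X` is an invariant linked family of
subsets of `X` not properly contained in any other invariant linked family. -/
def IsMaxInvLinked {X : Type*} [Group X] (L : Set (Set X)) : Prop :=
  Linked L ∧ Invariant L ∧
    ∀ M : Set (Set X), Linked M → Invariant M → L ⊆ M → M = L

/-- A *maximal linked system* on `X` is a linked family of subsets of `X` not properly
contained in any other linked family. -/
def IsMaxLinked {X : Type*} (L : Set (Set X)) : Prop :=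
  Linked L ∧ ∀ M : Set (Set X), Linked M → L ⊆ M → M = L

/-- The operation `A∘B = {C ⊆ X : {x ∈ X : x⁻¹C ∈ B} ∈ A}`, where
`x⁻¹C = {y ∈ X : xy ∈ C}`. -/
def circ {X : Type*} [Group X] (A B : Set (Set X)) : Set (Set X) :=
  {C : Set X | {x : X | (x * ·) ⁻¹' C ∈ B} ∈ A}

open Set

section MaxLinked

variable {X : Type*}

theorem isMaxLinked_of_mem_or_compl_mem {L : Set (Set X)} (hL : Linked L)
    (h : ∀ C, C ∈ L ∨ Cᶜ ∈ L) : IsMaxLinked L := by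
  refine ⟨hL, fun M hM hLM => Subset.antisymm (fun C hC => ?_) hLM⟩
  rcases h C with h | h
  · exact h
  · obtain ⟨x, hx, hx'⟩ := hM C hC _ (hLM h)
    exact absurd hx hx'

theorem IsMaxLinked.mem_of_forall_inter_nonempty {L : Set (Set X)} (hL : IsMaxLinked L)
    {C : Set X} (hC : C.Nonempty) (h : ∀ A ∈ L, (A ∩ C).Nonempty) : C ∈ L := by
  have : insert C L = L := by
    refine hL.2 _ ?_ (subset_insert _ _)
    rintro A (rfl | hA) B (rfl | hB)
    · simpa using hC
    · rw [inter_comm]; exact h B hB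
    · exact h A hA
    · exact hL.1 A hA B hB
  rw [← this]
  exact mem_insert _ _

theorem IsMaxLinked.nonempty {L : Set (Set X)} (hL : IsMaxLinked L) {A : Set X} (hA : A ∈ L) :
    A.Nonempty := by
  simpa using hL.1 A hA A hA

theorem IsMaxLinked.mem_of_subset {L : Set (Set X)} (hL : IsMaxLinked L) {A B : Set X}
    (hA : A ∈ L) (h : A ⊆ B) : B ∈ L :=
  hL.mem_of_forall_inter_nonempty ((hL.nonempty hA).mono h) fun D hD =>
    (hL.1 D hD A hA).mono (inter_subset_inter_right D h)

theorem IsMaxLinked.univ_mem [Nonempty X] {L : Set (Set X)} (hL : IsMaxLinked L) : univ ∈ L :=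
  hL.mem_of_forall_inter_nonempty univ_nonempty fun A hA => by simpa using hL.nonempty hA

theorem IsMaxLinked.empty_notMem {L : Set (Set X)} (hL : IsMaxLinked L) : ∅ ∉ L :=
  fun h => not_nonempty_empty (hL.nonempty h)

theorem IsMaxLinked.compl_mem_iff [Nonempty X] {L : Set (Set X)} (hL : IsMaxLinked L)
    {C : Set X} : Cᶜ ∈ L ↔ C ∉ L := by
  refine ⟨fun h h' => by simpa using hL.1 C h' _ h, fun h => ?_⟩
  by_contra h'
  apply h
  refine hL.mem_of_forall_inter_nonempty ?_ fun A hA => ?_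
  · rw [nonempty_iff_ne_empty]
    rintro rfl
    exact h' (by simpa using hL.univ_mem)
  · by_contra hAC
    exact h' (hL.mem_of_subset hA fun x hx hxC => hAC ⟨x, hx, hxC⟩)

theorem isMaxLinked_principal (x : X) : IsMaxLinked {C : Set X | x ∈ C} :=
  isMaxLinked_of_mem_or_compl_mem (fun _ hA _ hB => ⟨x, hA, hB⟩) fun C => em (x ∈ C)

theorem Linked.exists_isMaxLinked {L : Set (Set X)} (hL : Linked L) :
    ∃ M, IsMaxLinked M ∧ L ⊆ M := by
  obtain ⟨M, hLM, hM⟩ := zorn_subset_nonempty {M : Set (Set X) | Linked M} (fun c hc hchain _ => by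
    refine ⟨⋃₀ c, ?_, fun s hs => subset_sUnion_of_mem hs⟩
    rintro A ⟨s, hs, hA⟩ B ⟨t, ht, hB⟩
    rcases hchain.total hs ht with h | h
    · exact hc ht A (h hA) B hB
    · exact hc hs A hA B (h hB)) L hL
  exact ⟨M, ⟨hM.prop, fun N hN hMN => (hM.eq_of_subset hN hMN).symm⟩, hLM⟩

end MaxLinked

section Zero

variable {X : Type*} [Group X]

/-- A zero of the superextension of `X`. -/
def IsSuperextensionZero (Z : Set (Set X)) : Prop :=
  IsMaxLinked Z ∧ ∀ A : Set (Set X), IsMaxLinked A → circ A Z = Z ∧ circ Z A = Z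

/-- A set meeting all of its left translates. -/
def SelfLinked (C : Set X) : Prop :=
  ∀ g : X, ∃ c ∈ C, g * c ∈ C

theorem IsSuperextensionZero.mem_of_selfLinked {Z : Set (Set X)} (hZ : IsSuperextensionZero Z)
    {C : Set X} (hC : SelfLinked C) : C ∈ Z := by
  have hlinked : Linked (range fun x : X => (x * ·) ⁻¹' C) := by
    rintro _ ⟨x, rfl⟩ _ ⟨y, rfl⟩
    obtain ⟨c, hc, hgc⟩ := hC (y * x⁻¹)
    exact ⟨x⁻¹ * c, by simpa using hc, by simpa [mul_assoc] using hgc⟩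
  obtain ⟨A, hA, hCA⟩ := hlinked.exists_isMaxLinked
  rw [← (hZ.2 A hA).2]
  have : {x : X | (x * ·) ⁻¹' C ∈ A} = univ := eq_univ_of_forall fun x => hCA ⟨x, rfl⟩
  change {x : X | (x * ·) ⁻¹' C ∈ A} ∈ Z
  rw [this]
  exact hZ.1.univ_mem

theorem IsSuperextensionZero.not_disjoint {Z : Set (Set X)} (hZ : IsSuperextensionZero Z)
    {C D : Set X} (hC : SelfLinked C) (hD : SelfLinked D) : ¬ Disjoint C D :=
  not_disjoint_iff_nonempty_inter.2
    (hZ.1.1 C (hZ.mem_of_selfLinked hC) D (hZ.mem_of_selfLinked hD))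

theorem IsSuperextensionZero.preimage_mem_iff {Z : Set (Set X)} (hZ : IsSuperextensionZero Z)
    (x : X) (C : Set X) : (x * ·) ⁻¹' C ∈ Z ↔ C ∈ Z := by
  conv_rhs => rw [← (hZ.2 _ (isMaxLinked_principal x)).1]
  rfl

theorem IsSuperextensionZero.mul_self_ne_one {Z : Set (Set X)} (hZ : IsSuperextensionZero Z)
    {x : X} (hx : x ≠ 1) : x * x ≠ 1 := by
  intro hxx
  let _ : LinearOrder X := IsWellOrder.linearOrder WellOrderingRel
  let A : Set X := {g | g < x * g}
  have hA : (x * ·) ⁻¹' A = Aᶜ := by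
    ext g
    have hne : x * g ≠ g := by simpa using hx
    have : x * (x * g) = g := by rw [← mul_assoc, hxx, one_mul]
    simp only [A, mem_preimage, mem_ofPred_eq, mem_compl_iff, this, not_lt]
    exact ⟨le_of_lt, fun h => lt_of_le_of_ne h hne⟩
  have h := hZ.preimage_mem_iff x A
  rw [hA, hZ.1.compl_mem_iff] at h
  tauto

end Zero

section Infinite

open Cardinal

universe u

/-- In an infinite group one can choose, by transfinite recursion, pairwise disjoint pairs
`{f i, g i * f i}` for any family `g` of group elements of at most the same cardinality. -/
theorem exists_pairwise_disjoint_pairs {X : Type u} [Group X] [Infinite X] {ι : Type u}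
    (e : ι ≃ X) (g : ι → X) :
    ∃ f : ι → X, ∀ i j, i ≠ j →
      f i ≠ f j ∧ f i ≠ g j * f j ∧ g i * f i ≠ f j ∧ g i * f i ≠ g j * f j := by
  obtain ⟨r, hr, hord⟩ := Cardinal.exists_ord_eq X
  let s : ι → ι → Prop := fun i j => r (e i) (e j)
  have hs : WellFounded s := InvImage.wf e hr.wf
  have hex : ∀ (i : ι) (F : ∀ j, s j i → X), ∃ x, ∀ j (h : s j i),
      x ≠ F j h ∧ x ≠ g j * F j h ∧ g i * x ≠ F j h ∧ g i * x ≠ g j * F j h := by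
    intro i F
    let p : Set X := {y | r y (e i)}
    have hp : #p < #X := card_typein_lt (e i) hord
    let G : p → X := fun y => F (e.symm y) (by
      have hy : r y (e i) := y.2
      simpa [s] using hy)
    have hlt : ∀ H : p → X, #(range H) < #X := fun H => mk_range_le.trans_lt hp
    have hunion : ∀ s t : Set X, #s < #X → #t < #X → #(s ∪ t : Set X) < #X := fun s t hs ht =>
      (mk_union_le s t).trans_lt (add_lt_of_lt (aleph0_le_mk X) hs ht)
    have hbad := hunion _ _
      (hunion _ _ (hlt G) (hlt fun y => g (e.symm y) * G y))
      (hunion _ _ (hlt fun y => (g i)⁻¹ * G y)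
        (hlt fun y => (g i)⁻¹ * (g (e.symm y) * G y)))
    obtain ⟨x, hx⟩ := (ne_univ_iff_exists_notMem _).1 fun h =>
      (hbad.trans_eq (mk_univ.symm.trans (congrArg (fun s : Set X => #s) h.symm))).false
    simp only [mem_union, mem_range, not_or, not_exists, inv_mul_eq_iff_eq_mul] at hx
    obtain ⟨⟨h1, h2⟩, h3, h4⟩ := hx
    refine ⟨x, fun j h => ?_⟩
    have hG : G ⟨e j, h⟩ = F j h := by simp [G]
    have hj := e.symm_apply_apply j
    refine ⟨fun hx => h1 ⟨e j, h⟩ ?_, fun hx => h2 ⟨e j, h⟩ ?_, fun hx => h3 ⟨e j, h⟩ ?_,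
      fun hx => h4 ⟨e j, h⟩ ?_⟩ <;> simp only [hG, hj, hx]
  choose c hc using hex
  refine ⟨hs.fix c, fun i j hij => ?_⟩
  have key : ∀ i j, s j i → hs.fix c i ≠ hs.fix c j ∧ hs.fix c i ≠ g j * hs.fix c j ∧
      g i * hs.fix c i ≠ hs.fix c j ∧ g i * hs.fix c i ≠ g j * hs.fix c j := by
    intro i j h
    rw [hs.fix_eq c i]
    exact hc i _ j h
  rcases trichotomous_of r (e i) (e j) with h | h | h
  · obtain ⟨h1, h2, h3, h4⟩ := key j i h
    exact ⟨h1.symm, h3.symm, h2.symm, h4.symm⟩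
  · exact absurd (e.injective h) hij
  · exact key i j h

theorem exists_disjoint_selfLinked (X : Type*) [Group X] [Infinite X] :
    ∃ C D : Set X, SelfLinked C ∧ SelfLinked D ∧ Disjoint C D := by
  have hcard : #(X ⊕ X) = #X := by
    simp
  obtain ⟨e⟩ := Cardinal.eq.1 hcard
  obtain ⟨f, hf⟩ := exists_pairwise_disjoint_pairs e (Sum.elim id id)
  refine ⟨{x | ∃ g, x = f (.inl g) ∨ x = g * f (.inl g)},
    {x | ∃ g, x = f (.inr g) ∨ x = g * f (.inr g)},
    fun g => ⟨_, ⟨g, .inl rfl⟩, ⟨g, .inr rfl⟩⟩,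
    fun g => ⟨_, ⟨g, .inl rfl⟩, ⟨g, .inr rfl⟩⟩, ?_⟩
  rw [Set.disjoint_left]
  rintro x ⟨g, hg⟩ ⟨h, hh⟩
  obtain ⟨h1, h2, h3, h4⟩ := hf (.inl g) (.inr h) (by simp)
  simp only [Sum.elim_inl, Sum.elim_inr, id] at h1 h2 h3 h4
  rcases hg with rfl | rfl <;> rcases hh with hh | hh <;> contradiction

end Infinite

section Finite

variable {X : Type*} [Group X]

/-- A finite set that misses at most `2 * k` differences extends to a self-linked set
after adding at most `k` points. -/
theorem exists_selfLinked_superset [Finite X] (hX : ∀ x : X, x ≠ 1 → x * x ≠ 1) (k : ℕ)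
    (C : Set X) (hne : C.Nonempty) (hk : {g : X | ∀ c ∈ C, g * c ∉ C}.ncard ≤ 2 * k) :
    ∃ D : Set X, SelfLinked D ∧ D.ncard ≤ C.ncard + k := by
  induction k generalizing C with
  | zero =>
    have h0 := (ncard_eq_zero (toFinite _)).1 (Nat.le_zero.1 hk)
    refine ⟨C, fun g => ?_, le_rfl⟩
    by_contra h
    push Not at h
    exact (eq_empty_iff_forall_notMem.1 h0 g) h
  | succ k ih =>
    by_cases hC : SelfLinked C
    · exact ⟨C, hC, by omega⟩
    obtain ⟨g, hg⟩ : ∃ g, ∀ c ∈ C, g * c ∉ C := by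
      simpa [SelfLinked] using hC
    obtain ⟨c, hc⟩ := hne
    have hg' : ∀ c ∈ C, g⁻¹ * c ∉ C := fun d hd hd' => hg _ hd' (by simpa using hd)
    have hg1 : g ≠ 1 := by
      rintro rfl
      exact hg c hc (by simpa using hc)
    have hgg : g ≠ g⁻¹ := fun h => hX g hg1 (by nth_rw 2 [h]; simp)
    obtain ⟨D, hD, hDc⟩ := ih (insert (g * c) C) (insert_nonempty _ _) (by
      have hsub : {x : X | ∀ d ∈ insert (g * c) C, x * d ∉ insert (g * c) C} ⊆
          {x : X | ∀ c ∈ C, x * c ∉ C} \ {g, g⁻¹} := by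
        intro x hx
        refine ⟨fun d hd hxd => hx d (mem_insert_of_mem _ hd) (mem_insert_of_mem _ hxd), ?_⟩
        rintro (rfl | rfl)
        · exact hx c (mem_insert_of_mem _ hc) (mem_insert _ _)
        · exact hx (g * c) (mem_insert _ _) (mem_insert_of_mem _ (by simpa using hc))
      have h1 := ncard_le_ncard hsub (toFinite _)
      have hpair : ({g, g⁻¹} : Set X) ⊆ {x : X | ∀ c ∈ C, x * c ∉ C} := by
        rintro x (rfl | rfl)
        · exact hg
        · exact hg'
      have h2 := ncard_sdiff hpair (toFinite _)
      rw [ncard_pair hgg] at h2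
      omega)
    have := ncard_insert_le (g * c) C
    exact ⟨D, hD, by omega⟩

theorem eq_of_mul_self_eq_mul_self_of_odd [Finite X] (hodd : Odd (Nat.card X)) {x y : X}
    (h : x * x = y * y) : x = y := by
  obtain ⟨m, hm⟩ := hodd
  have hz : ∀ z : X, (z * z) ^ (m + 1) = z := fun z => by
    rw [← pow_two, ← pow_mul, show 2 * (m + 1) = Nat.card X + 1 by omega, pow_succ,
      pow_card_eq_one', one_mul]
  rw [← hz x, h, hz y]

theorem exists_selfLinked_of_odd [Finite X] (hodd : Odd (Nat.card X)) (h7 : 7 ≤ Nat.card X) :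
    ∃ C : Set X, SelfLinked C ∧ 2 * C.ncard < Nat.card X := by
  have hX : ∀ x : X, x ≠ 1 → x * x ≠ 1 := fun x hx h =>
    hx (eq_of_mul_self_eq_mul_self_of_odd hodd (by simpa using h))
  have : Nontrivial X := Finite.one_lt_card_iff_nontrivial.1 (by omega)
  obtain ⟨a, ha⟩ := exists_ne (1 : X)
  obtain ⟨m, hm⟩ := hodd
  obtain ⟨r, hr⟩ : ∃ r : X, r * r = a :=
    Finite.surjective_of_injective (f := fun x : X => x * x)
      (fun _ _ h => eq_of_mul_self_eq_mul_self_of_odd ⟨m, hm⟩ h) a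
  obtain ⟨b, hb⟩ : ∃ b, b ∉ ({1, a, a⁻¹, a * a, r} : Set X) := by
    by_contra! h
    have h1 := ncard_univ X
    rw [← eq_univ_of_forall h] at h1
    have h2 := ncard_insert_le (1 : X) {a, a⁻¹, a * a, r}
    have h3 := ncard_insert_le a {a⁻¹, a * a, r}
    have h4 := ncard_insert_le a⁻¹ {a * a, r}
    have h5 := ncard_insert_le (a * a) {r}
    have h6 := ncard_singleton r
    omega
  simp only [mem_insert_iff, mem_singleton_iff, not_or] at hb
  obtain ⟨hb1, hba, hba', hbaa, hbr⟩ := hb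
  have hbb : b * b ≠ a := fun h =>
    hbr (eq_of_mul_self_eq_mul_self_of_odd ⟨m, hm⟩ (h.trans hr.symm))
  obtain ⟨d, hd⟩ : ∃ d, d = b * a⁻¹ := ⟨_, rfl⟩
  have hbd : b = d * a := by simp [hd]
  have hd1 : d ≠ 1 := by rintro rfl; simp at hbd; exact hba hbd
  have hda : d ≠ a := by rintro rfl; exact hbaa hbd
  have hda' : d ≠ a⁻¹ := by rintro rfl; simp at hbd; exact hb1 hbd
  have hdb : d ≠ b := by rintro rfl; simp at hbd; exact ha hbd
  have hdb' : d ≠ b⁻¹ := by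
    intro h
    apply hbb
    nth_rw 2 [hbd]
    simp [h]
  have hne : ∀ x : X, x ≠ 1 → x ≠ x⁻¹ := fun x hx h => hX x hx (by nth_rw 2 [h]; simp)
  have haa := hne a ha
  have hbb' := hne b hb1
  have hdd := hne d hd1
  let W : Set X := {1, a, a⁻¹, b, b⁻¹, d, d⁻¹}
  have hW : W.ncard = 7 := by
    classical
    have : W = (({1, a, a⁻¹, b, b⁻¹, d, d⁻¹} : Finset X) : Set X) := by simp [W]
    rw [this, ncard_coe_finset]
    have hab := Ne.symm hba
    have e1 : a ≠ b⁻¹ := fun h => hba' (by simp [h])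
    have e2 : a ≠ d⁻¹ := fun h => hda' (by simp [h])
    have e3 : b ≠ d⁻¹ := fun h => hdb' (by simp [h])
    repeat rw [Finset.card_insert_of_notMem]
    · simp
    all_goals
      simp [inv_eq_iff_eq_inv, haa, hbb', hdd, hab, e1, e2, e3, ha.symm, Ne.symm hb1, hd1.symm,
        hda.symm, hdb.symm, Ne.symm hba', hda'.symm, hdb'.symm, ha, hb1, hd1]
  obtain ⟨D, hD, hDc⟩ := exists_selfLinked_superset hX (m - 3) {1, a, b} (insert_nonempty _ _) (by
    have hsub : {g : X | ∀ c ∈ ({1, a, b} : Set X), g * c ∉ ({1, a, b} : Set X)} ⊆ Wᶜ := by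
      rintro g hg (rfl | rfl | rfl | rfl | rfl | rfl | rfl)
      · exact hg 1 (by simp) (by simp)
      · exact hg 1 (by simp) (by simp)
      · exact hg a (by simp) (by simp)
      · exact hg 1 (by simp) (by simp)
      · exact hg b (by simp) (by simp)
      · exact hg a (by simp) (by simp [← hbd])
      · exact hg b (by simp) (by simp [hbd])
    have h1 := ncard_le_ncard hsub (toFinite _)
    have h2 := ncard_add_ncard_compl W
    omega)
  refine ⟨D, hD, ?_⟩
  have h1 := ncard_insert_le 1 {a, b}
  have h2 := ncard_insert_le a {b}
  have h3 := ncard_singleton b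
  omega

theorem selfLinked_of_card_lt [Finite X] {C : Set X} (hC : Nat.card X < 2 * C.ncard) :
    SelfLinked C := by
  intro g
  by_contra! h
  have hdisj : Disjoint ((g * ·) '' C) C := by
    rw [Set.disjoint_left]
    rintro _ ⟨c, hc, rfl⟩
    exact h c hc
  have h1 := ncard_union_eq hdisj (toFinite _) (toFinite _)
  rw [ncard_image_of_injective _ (mul_right_injective g)] at h1
  have h2 := ncard_le_card (((g * ·) '' C) ∪ C)
  omega

theorem IsSuperextensionZero.finite_and_card {Z : Set (Set X)} (hZ : IsSuperextensionZero Z) :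
    Finite X ∧ (Nat.card X = 1 ∨ Nat.card X = 3 ∨ Nat.card X = 5) := by
  have hfin : Finite X := by
    by_contra h
    have : Infinite X := not_finite_iff_infinite.1 h
    obtain ⟨C, D, hC, hD, hCD⟩ := exists_disjoint_selfLinked X
    exact hZ.not_disjoint hC hD hCD
  refine ⟨hfin, ?_⟩
  have hodd : Odd (Nat.card X) := by
    by_contra h
    rw [Nat.not_odd_iff_even, even_iff_two_dvd] at h
    obtain ⟨x, hx⟩ := exists_prime_orderOf_dvd_card' 2 h
    refine hZ.mul_self_ne_one (x := x) ?_ ?_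
    · rintro rfl
      simp at hx
    · rw [← pow_two, ← hx, pow_orderOf_eq_one]
  have h7 : ¬ 7 ≤ Nat.card X := by
    intro h7
    obtain ⟨C, hC, hCc⟩ := exists_selfLinked_of_odd hodd h7
    refine hZ.not_disjoint hC (selfLinked_of_card_lt (C := Cᶜ) ?_) disjoint_compl_right
    have := ncard_add_ncard_compl C
    omega
  obtain ⟨m, hm⟩ := hodd
  omega

/-- The family of all subsets containing more than half of the points. -/
def majority (X : Type*) : Set (Set X) :=
  {C | Nat.card X < 2 * C.ncard}

theorem compl_mem_majority_of_odd {X : Type*} [Finite X] (hodd : Odd (Nat.card X)) {C : Set X}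
    (hC : C ∉ majority X) : Cᶜ ∈ majority X := by
  obtain ⟨m, hm⟩ := hodd
  have := ncard_add_ncard_compl C
  simp only [majority, mem_ofPred_eq] at hC ⊢
  omega

theorem isMaxLinked_majority {X : Type*} [Finite X] (hodd : Odd (Nat.card X)) :
    IsMaxLinked (majority X) := by
  refine isMaxLinked_of_mem_or_compl_mem (fun A hA B hB => ?_) fun C =>
    or_iff_not_imp_left.2 (compl_mem_majority_of_odd hodd)
  rw [← not_disjoint_iff_nonempty_inter]
  intro hAB
  have h1 := ncard_union_eq hAB (toFinite _) (toFinite _)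
  have h2 := ncard_le_card (A ∪ B)
  simp only [majority, mem_ofPred_eq] at hA hB
  omega

theorem preimage_mul_left_mem_majority {C : Set X} (x : X) :
    (x * ·) ⁻¹' C ∈ majority X ↔ C ∈ majority X := by
  have : ((x * ·) ⁻¹' C).ncard = C.ncard :=
    ncard_preimage_of_injective_subset_range (mul_right_injective x)
      fun c _ => ⟨x⁻¹ * c, by simp⟩
  simp only [majority, mem_ofPred_eq, this]

/-- In a group of order `1`, `3` or `5`, more than half of the translates of a set with less
than half of the points cannot be pairwise intersecting. -/
theorem exists_disjoint_translates [Finite X]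
    (hcard : Nat.card X = 1 ∨ Nat.card X = 3 ∨ Nat.card X = 5) {D T : Set X}
    (hD : 2 * D.ncard < Nat.card X) (hT : T ∈ majority X) :
    ∃ x ∈ T, ∃ y ∈ T, Disjoint ((x * ·) ⁻¹' D) ((y * ·) ⁻¹' D) := by
  simp only [majority, mem_ofPred_eq] at hT
  by_contra! hcon
  have hmeet : ∀ x ∈ T, ∀ y ∈ T, ∃ d ∈ D, ∃ e ∈ D, y * x⁻¹ = e * d⁻¹ := by
    intro x hx y hy
    obtain ⟨z, hzx, hzy⟩ := not_disjoint_iff.1 (hcon x hx y hy)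
    exact ⟨x * z, hzx, y * z, hzy, by group⟩
  have hTne : T.Nonempty := by
    rw [← ncard_pos (toFinite T)]
    omega
  have hDne : D.Nonempty := by
    obtain ⟨x, hx⟩ := hTne
    obtain ⟨d, hd, -⟩ := hmeet x hx x hx
    exact ⟨d, hd⟩
  have hDpos := (ncard_pos (toFinite D)).2 hDne
  by_cases hD1 : D.ncard = 1
  · obtain ⟨d, rfl⟩ := ncard_eq_one.1 hD1
    obtain ⟨x, hx, y, hy, hxy⟩ := (one_lt_ncard (toFinite T)).1 (by omega)
    obtain ⟨_, rfl, _, rfl, h⟩ := hmeet x hx y hy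
    rw [mul_inv_cancel, mul_inv_eq_one] at h
    exact hxy h.symm
  · have h5 : Nat.card X = 5 := by omega
    obtain ⟨a, b, -, rfl⟩ := ncard_eq_two.1 (show D.ncard = 2 by omega)
    obtain ⟨x, hx, y, hy, z, hz, hxy, hxz, hyz⟩ := (two_lt_ncard (toFinite T)).1 (by omega)
    have hq : ∀ x ∈ T, ∀ y ∈ T, x ≠ y → y * x⁻¹ = a * b⁻¹ ∨ y * x⁻¹ = (a * b⁻¹)⁻¹ := by
      intro x hx y hy hxy
      have hne : y * x⁻¹ ≠ 1 := fun h => hxy (mul_inv_eq_one.1 h).symm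
      obtain ⟨d, hd, e, he, h⟩ := hmeet x hx y hy
      rcases hd with rfl | rfl <;> rcases he with rfl | rfl <;> simp_all
    have hprod : z * x⁻¹ = (z * y⁻¹) * (y * x⁻¹) := by group
    have hzx1 : z * x⁻¹ ≠ 1 := fun h => hxz (mul_inv_eq_one.1 h).symm
    have hq5 : (a * b⁻¹) ^ 5 = 1 := by rw [← h5]; exact pow_card_eq_one'
    have h1 := hq x hx y hy hxy
    have h2 := hq y hy z hz hyz
    have h3 := hq x hx z hz hxz
    generalize a * b⁻¹ = q at h1 h2 h3 hq5
    have hq1 : q ≠ 1 := by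
      rintro rfl
      simp_all
    have hq3 : q ^ 3 ≠ 1 := by
      intro h
      apply hq1
      calc q = (q ^ 3) ^ 2 * (q ^ 5)⁻¹ := by group
        _ = 1 := by simp [h, hq5]
    rcases h1 with h1 | h1 <;> rcases h2 with h2 | h2 <;> rw [h1, h2] at hprod
    · rcases h3 with h3 | h3 <;> rw [h3] at hprod
      · exact hq1 (by simpa using hprod)
      · apply hq3
        rw [pow_succ, pow_two, ← hprod, inv_mul_cancel]
    · exact hzx1 (by simpa using hprod)
    · exact hzx1 (by simpa using hprod)
    · rcases h3 with h3 | h3 <;> rw [h3] at hprod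
      · apply hq3
        rw [pow_succ, pow_two]
        nth_rw 3 [hprod]
        group
      · exact hq1 (by simpa using hprod)

theorem isSuperextensionZero_majority [Finite X]
    (hcard : Nat.card X = 1 ∨ Nat.card X = 3 ∨ Nat.card X = 5) :
    IsSuperextensionZero (majority X) := by
  have hodd : Odd (Nat.card X) := by
    rcases hcard with h | h | h <;> rw [h] <;> decide
  have hmax := isMaxLinked_majority hodd
  refine ⟨hmax, fun A hA => ⟨?_, ?_⟩⟩
  · ext C
    simp only [circ, mem_ofPred_eq, preimage_mul_left_mem_majority]
    by_cases hC : C ∈ majority X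
    · simpa [hC] using hA.univ_mem
    · simpa [hC] using hA.empty_notMem
  · have hsub : ∀ C ∈ majority X, C ∈ circ (majority X) A := by
      intro C hC
      by_contra hS
      obtain ⟨x, hx, y, hy, hxy⟩ := exists_disjoint_translates hcard (D := Cᶜ)
        (by
          have := ncard_add_ncard_compl C
          simp only [majority, mem_ofPred_eq] at hC
          omega)
        (compl_mem_majority_of_odd hodd hS)
      have hmem : ∀ x ∈ {x : X | (x * ·) ⁻¹' C ∈ A}ᶜ, (x * ·) ⁻¹' Cᶜ ∈ A := fun x hx => by
        rw [preimage_compl]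
        exact hA.compl_mem_iff.2 hx
      exact not_disjoint_iff_nonempty_inter.2 (hA.1 _ (hmem x hx) _ (hmem y hy)) hxy
    refine Subset.antisymm (fun C hC => ?_) hsub
    by_contra hC'
    have h := hsub _ (compl_mem_majority_of_odd hodd hC')
    refine hmax.compl_mem_iff.1 ?_ hC
    have hcompl : {x : X | (x * ·) ⁻¹' C ∈ A}ᶜ = {x : X | (x * ·) ⁻¹' Cᶜ ∈ A} := by
      ext x
      exact hA.compl_mem_iff.symm
    rw [hcompl]
    exact h

end Finite

/-- The superextension `λ(X)` of a group `X` has a zero (a maximal linked system `Z` with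
`A∘Z = Z = Z∘A` for every maximal linked system `A`) if and only if `X` is finite and
`|X| ∈ {1, 3, 5}` (equivalently, `X ≅ C₁`, `C₃` or `C₅`). -/
theorem stmt18 {X : Type*} [Group X] :
    (∃ Z : Set (Set X), IsMaxLinked Z ∧
        ∀ A : Set (Set X), IsMaxLinked A → circ A Z = Z ∧ circ Z A = Z) ↔
      (Finite X ∧ (Nat.card X = 1 ∨ Nat.card X = 3 ∨ Nat.card X = 5)) := by
  exact ⟨fun ⟨_, hZ⟩ => IsSuperextensionZero.finite_and_card hZ,
    fun ⟨_, hcard⟩ => ⟨majority X, isSuperextensionZero_majority hcard⟩⟩
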